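/- arXiv:0712.1275 — 2 statements merged into one kernel-verified Lean document; each statement's English description precedes it below -/
import Mathlib

section
/- Let b ∈ ℝ. Almost surely, the level set L_ω(b) := {t ∈ [0,∞) : ω(t) = b} has no isolated points in [0,∞); that is, the set of ω ∈ Ω for which L_ω(b) has an isolated point is null. -/
open Filter Topology MeasureTheory
open scoped ENNReal NNReal

namespace GTP

/-- The sample space `Ω`: all continuous functions `ω : [0,∞) → ℝ`. -/
def Omega : Type := {f : ℝ≥0 → ℝ // Continuous f}

/-- The filtration: `F t` is the smallest σ-algebra on `Ω` making all maps
`ω ↦ ω s`, `s ∈ [0,t]`, measurable. -/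
def F (t : ℝ≥0) : MeasurableSpace Omega :=
  ⨆ s : {s : ℝ≥0 // s ≤ t},
    MeasurableSpace.comap (fun ω : Omega => ω.1 s.1) inferInstance

/-- A stopping time relative to the filtration `(F t)`, with values in `[0,∞]`. -/
def IsStopping (τ : Omega → ℝ≥0∞) : Prop :=
  ∀ t : ℝ≥0, MeasurableSet[F t] {ω : Omega | τ ω ≤ (t : ℝ≥0∞)}

/-- `F_τ`-measurability of a function `h : Ω → ℝ`. -/
def MeasurableAtTime (τ : Omega → ℝ≥0∞) (h : Omega → ℝ) : Prop :=
  ∀ B : Set ℝ, MeasurableSet B → ∀ t : ℝ≥0,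
    MeasurableSet[F t] (h ⁻¹' B ∩ {ω : Omega | τ ω ≤ (t : ℝ≥0∞)})

/-- An elementary trading strategy: an increasing sequence of stopping times
`τ₁ ≤ τ₂ ≤ ⋯` tending to `∞`, together with bounded `F_{τ_n}`-measurable
portfolio functions `h_n`. -/
structure ElemStrategy where
  τ : ℕ → Omega → ℝ≥0∞
  stopping : ∀ n, IsStopping (τ n)
  mono : ∀ n ω, τ n ω ≤ τ (n + 1) ω
  tendsto_top : ∀ ω, Tendsto (fun n => τ n ω) atTop (𝓝 ⊤)
  h : ℕ → Omega → ℝ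
  h_bdd : ∀ n, ∃ C : ℝ, ∀ ω, |h n ω| ≤ C
  h_meas : ∀ n, MeasurableAtTime (τ n) (h n)

/-- The time `τ ∧ t` as an element of `[0,∞)`. -/
noncomputable def clip (τ : Omega → ℝ≥0∞) (t : ℝ≥0) (ω : Omega) : ℝ≥0 :=
  (min (τ ω) (t : ℝ≥0∞)).toNNReal

/-- The elementary capital process
`K_t(ω) := c + Σ_n h_n(ω) (ω(τ_{n+1} ∧ t) − ω(τ_n ∧ t))`. -/
noncomputable def elemCapital (G : ElemStrategy) (c : ℝ) (t : ℝ≥0) (ω : Omega) : ℝ :=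
  c + ∑' n : ℕ, G.h n ω * (ω.1 (clip (G.τ (n + 1)) t ω) - ω.1 (clip (G.τ n) t ω))

/-- A positive capital process: a countable sum of nonnegative elementary capital
processes with strictly positive summable initial capitals. -/
structure PosCapital where
  G : ℕ → ElemStrategy
  c : ℕ → ℝ
  c_pos : ∀ n, 0 < c n
  c_summable : Summable c
  nonneg : ∀ n t ω, 0 ≤ elemCapital (G n) (c n) t ω

/-- The value `S_t(ω) ∈ [0,∞]` of a positive capital process. -/
noncomputable def PosCapital.value (S : PosCapital) (t : ℝ≥0) (ω : Omega) : ℝ≥0∞ :=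
  ∑' n : ℕ, ENNReal.ofReal (elemCapital (S.G n) (S.c n) t ω)

/-- The initial value `S_0` of a positive capital process (independent of `ω`,
since `K^{G_n,c_n}_0 = c_n`). -/
noncomputable def PosCapital.init (S : PosCapital) : ℝ≥0∞ :=
  ∑' n : ℕ, ENNReal.ofReal (S.c n)

/-- Upper probability:
`UpProb(E) := inf { S₀ : S a positive capital process, liminf_{t→∞} S_t ≥ 1_E }`. -/
noncomputable def UpProb (E : Set Omega) : ℝ≥0∞ :=
  ⨅ (S : PosCapital) (_ : ∀ ω : Omega,
      E.indicator (fun _ => (1 : ℝ≥0∞)) ω ≤ liminf (fun t : ℝ≥0 => S.value t ω) atTop),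
    S.init

/-- A set is null if its upper probability is `0`. -/
def IsNull (E : Set Omega) : Prop := UpProb E = 0

theorem meas_eval {s t : ℝ≥0} (h : s ≤ t) :
    @Measurable Omega ℝ (F t) _ (fun ω : Omega => ω.1 s) := by
  have h1 : MeasurableSpace.comap (fun ω : Omega => ω.1 s) inferInstance ≤ F t :=
    le_iSup (fun s : {s : ℝ≥0 // s ≤ t} =>
      MeasurableSpace.comap (fun ω : Omega => ω.1 s.1) (inferInstance : MeasurableSpace ℝ))
      (⟨s, h⟩ : {s : ℝ≥0 // s ≤ t})
  exact (comap_measurable (fun ω : Omega => ω.1 s)).mono h1 le_rfl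

/-- A projection over a compact set of a closed condition is measurable. -/
theorem meas_exists {X : Type} [TopologicalSpace X] [SecondCountableTopology X]
    {Y : Type} (m : MeasurableSpace Y) (K : Set X) (hK : IsCompact K) (g : Y → X → ℝ)
    (hc : ∀ y, Continuous (g y)) (hm : ∀ x ∈ K, Measurable (fun y => g y x)) :
    MeasurableSet {y | ∃ x ∈ K, g y x ≤ 0} := by
  obtain ⟨D, hDc, hDd⟩ := TopologicalSpace.exists_countable_dense K
  have key : {y | ∃ x ∈ K, g y x ≤ 0} =
      ⋂ k : ℕ, ⋃ x ∈ D, {y | g y (x : K) < 1 / ((k : ℝ) + 1)} := by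
    ext y
    simp only [Set.mem_setOf_eq, Set.mem_iInter, Set.mem_iUnion]
    constructor
    · rintro ⟨x, hx, hgx⟩ k
      have hpos : (0 : ℝ) < 1 / ((k : ℝ) + 1) := by positivity
      have ho : IsOpen {z : K | g y z < 1 / ((k : ℝ) + 1)} :=
        isOpen_lt ((hc y).comp continuous_subtype_val) continuous_const
      obtain ⟨z, hz, hzD⟩ := hDd.inter_open_nonempty _ ho ⟨⟨x, hx⟩, lt_of_le_of_lt hgx hpos⟩
      exact ⟨z, hzD, hz⟩
    · intro h
      obtain ⟨z0, _, _⟩ := h 0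
      obtain ⟨x, hx, hmin⟩ := hK.exists_isMinOn ⟨z0.1, z0.2⟩ (hc y).continuousOn
      refine ⟨x, hx, ?_⟩
      by_contra hcon
      push Not at hcon
      obtain ⟨k, hk⟩ := exists_nat_one_div_lt hcon
      obtain ⟨z, _, hz⟩ := h k
      have : g y x ≤ g y z := hmin z.2
      linarith
  rw [key]
  refine MeasurableSet.iInter fun k => MeasurableSet.biUnion hDc fun x _ => ?_
  exact measurableSet_lt (hm x.1 x.2) measurable_const

noncomputable def hit (P : Omega → Set ℝ≥0) (ω : Omega) : ℝ≥0∞ := ⨅ r ∈ P ω, (r : ℝ≥0∞)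

theorem hit_le_of_mem {P : Omega → Set ℝ≥0} {ω : Omega} {r : ℝ≥0} (h : r ∈ P ω) :
    hit P ω ≤ r := iInf₂_le r h

theorem hit_cases (P : Omega → Set ℝ≥0) (ω : Omega) (hP : IsClosed (P ω)) :
    (hit P ω = ⊤ ∧ P ω = ∅) ∨
      ∃ r ∈ P ω, hit P ω = (r : ℝ≥0∞) ∧ ∀ s ∈ P ω, r ≤ s := by
  rcases (P ω).eq_empty_or_nonempty with h | h
  · left
    exact ⟨by simp [hit, h], h⟩
  · right
    have hm : sInf (P ω) ∈ P ω := hP.csInf_mem h (OrderBot.bddBelow _)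
    have hle : ∀ s ∈ P ω, sInf (P ω) ≤ s := fun s hs => csInf_le (OrderBot.bddBelow _) hs
    refine ⟨sInf (P ω), hm, le_antisymm (hit_le_of_mem hm) ?_, hle⟩
    exact le_iInf₂ fun s hs => ENNReal.coe_le_coe.2 (hle s hs)

theorem hit_le_iff (P : Omega → Set ℝ≥0) (ω : Omega) (hP : IsClosed (P ω)) (t : ℝ≥0) :
    hit P ω ≤ t ↔ ∃ r ∈ P ω, r ≤ t := by
  constructor
  · intro h
    rcases hit_cases P ω hP with ⟨h1, _⟩ | ⟨r, hr, h1, _⟩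
    · rw [h1] at h; simp at h
    · rw [h1] at h; exact ⟨r, hr, ENNReal.coe_le_coe.1 h⟩
  · rintro ⟨r, hr, hrt⟩
    exact (hit_le_of_mem hr).trans (ENNReal.coe_le_coe.2 hrt)

/-- times after `a` at which the path is at `b` -/
def PA (a : ℝ≥0) (b : ℝ) (ω : Omega) : Set ℝ≥0 := {s | a ≤ s ∧ ω.1 s = b}

/-- the gap function -/
noncomputable def gap (b e c x : ℝ) : ℝ := min (e * (x - b) + c) (1 - e * (x - b))

/-- times after the first visit in `PA` at which `e (ω - b)` is outside `(-c, 1)` -/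
def PB (a : ℝ≥0) (b e c : ℝ) (ω : Omega) : Set ℝ≥0 :=
  {r | ∃ s ∈ PA a b ω, s ≤ r ∧ gap b e c (ω.1 r) ≤ 0}

theorem gap_cont (b e c : ℝ) : Continuous (gap b e c) := by
  unfold gap; fun_prop

theorem PA_closed (a : ℝ≥0) (b : ℝ) (ω : Omega) : IsClosed (PA a b ω) :=
  (isClosed_le continuous_const continuous_id).inter
    (isClosed_eq ω.2 continuous_const)

theorem PB_closed (a : ℝ≥0) (b e c : ℝ) (ω : Omega) : IsClosed (PB a b e c ω) := by
  rcases hit_cases (PA a b) ω (PA_closed a b ω) with ⟨_, h⟩ | ⟨s, hs, _, hmin⟩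
  · have : PB a b e c ω = ∅ := by ext r; simp [PB, h]
    rw [this]; exact isClosed_empty
  · have : PB a b e c ω = {r | s ≤ r} ∩ {r | gap b e c (ω.1 r) ≤ 0} := by
      ext r
      constructor
      · rintro ⟨s', hs', h1, h2⟩
        exact ⟨(hmin s' hs').trans h1, h2⟩
      · rintro ⟨h1, h2⟩
        exact ⟨s, hs, h1, h2⟩
    rw [this]
    exact (isClosed_le continuous_const continuous_id).inter
      (isClosed_le ((gap_cont b e c).comp ω.2) continuous_const)

theorem PA_stopping (a : ℝ≥0) (b : ℝ) : IsStopping (hit (PA a b)) := by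
  intro t
  have : {ω : Omega | hit (PA a b) ω ≤ (t : ℝ≥0∞)} =
      {ω : Omega | ∃ s ∈ Set.Icc a t, |ω.1 s - b| ≤ 0} := by
    ext ω
    simp only [Set.mem_setOf_eq]
    rw [hit_le_iff _ _ (PA_closed a b ω)]
    constructor
    · rintro ⟨r, ⟨h1, h2⟩, h3⟩
      exact ⟨r, ⟨h1, h3⟩, by simp [h2]⟩
    · rintro ⟨r, ⟨h1, h3⟩, h2⟩
      exact ⟨r, ⟨h1, sub_eq_zero.1 (abs_nonpos_iff.1 h2)⟩, h3⟩
  rw [this]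
  refine meas_exists (F t) (Set.Icc a t) isCompact_Icc (fun ω s => |ω.1 s - b|) ?_ ?_
  · intro ω
    exact (ω.2.sub continuous_const).abs
  · intro s hs
    have h1 := meas_eval hs.2
    exact (continuous_abs.measurable).comp (h1.sub measurable_const)

theorem PB_stopping (a : ℝ≥0) (b e c : ℝ) : IsStopping (hit (PB a b e c)) := by
  intro t
  have : {ω : Omega | hit (PB a b e c) ω ≤ (t : ℝ≥0∞)} =
      {ω : Omega | ∃ p ∈ (Set.Icc a t ×ˢ Set.Icc a t) ∩ {p : ℝ≥0 × ℝ≥0 | p.1 ≤ p.2},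
        max |ω.1 p.1 - b| (gap b e c (ω.1 p.2)) ≤ 0} := by
    ext ω
    simp only [Set.mem_setOf_eq]
    rw [hit_le_iff _ _ (PB_closed a b e c ω)]
    constructor
    · rintro ⟨r, ⟨s, ⟨h1, h2⟩, h3, h4⟩, h5⟩
      exact ⟨(s, r), ⟨⟨⟨h1, h3.trans h5⟩, ⟨h1.trans h3, h5⟩⟩, h3⟩, max_le (by simp [h2]) h4⟩
    · rintro ⟨⟨s, r⟩, ⟨⟨h1, h2⟩, h3⟩, h4⟩
      exact ⟨r, ⟨s, ⟨h1.1, sub_eq_zero.1 (abs_nonpos_iff.1 ((le_max_left _ _).trans h4))⟩, h3,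
        (le_max_right _ _).trans h4⟩, h2.2⟩
  rw [this]
  refine meas_exists (F t) _ ?_
    (fun ω (p : ℝ≥0 × ℝ≥0) => max |ω.1 p.1 - b| (gap b e c (ω.1 p.2))) ?_ ?_
  · exact (isCompact_Icc.prod isCompact_Icc).inter_right
      (isClosed_le continuous_fst continuous_snd)
  · intro ω
    exact (((ω.2.comp continuous_fst).sub continuous_const).abs).max
      ((gap_cont b e c).comp (ω.2.comp continuous_snd))
  · intro p hp
    have h1 := meas_eval hp.1.1.2
    have h2 := meas_eval hp.1.2.2
    exact Measurable.max ((continuous_abs.measurable).comp (h1.sub measurable_const))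
      ((gap_cont b e c).measurable.comp h2)

theorem const_meas (τ : Omega → ℝ≥0∞) (hτ : IsStopping τ) (x : ℝ) :
    MeasurableAtTime τ (fun _ => x) := by
  intro B _ t
  by_cases hx : x ∈ B
  · have : (fun _ : Omega => x) ⁻¹' B = Set.univ := by ext; simp [hx]
    rw [this, Set.univ_inter]; exact hτ t
  · have : (fun _ : Omega => x) ⁻¹' B = ∅ := by ext; simp [hx]
    rw [this, Set.empty_inter]; exact @MeasurableSet.empty _ (F t)

noncomputable def tau (a : ℝ≥0) (b e c : ℝ) : ℕ → Omega → ℝ≥0∞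
  | 0 => hit (PA a b)
  | 1 => hit (PB a b e c)
  | _ + 2 => fun _ => ⊤

noncomputable def hh (e : ℝ) : ℕ → ℝ
  | 0 => e
  | _ + 1 => 0

theorem tau_stopping (a : ℝ≥0) (b e c : ℝ) : ∀ n, IsStopping (tau a b e c n)
  | 0 => PA_stopping a b
  | 1 => PB_stopping a b e c
  | n + 2 => by
    intro t
    have : {ω : Omega | tau a b e c (n + 2) ω ≤ (t : ℝ≥0∞)} = ∅ := by ext; simp [tau]
    rw [this]; exact @MeasurableSet.empty _ (F t)

theorem hit_PA_le_PB (a : ℝ≥0) (b e c : ℝ) (ω : Omega) :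
    hit (PA a b) ω ≤ hit (PB a b e c) ω := by
  refine le_iInf₂ fun r hr => ?_
  obtain ⟨s, hs, hsr, _⟩ := hr
  exact (hit_le_of_mem hs).trans (ENNReal.coe_le_coe.2 hsr)

noncomputable def strat (a : ℝ≥0) (b e c : ℝ) : ElemStrategy where
  τ := tau a b e c
  stopping := tau_stopping a b e c
  mono := by
    intro n ω
    match n with
    | 0 => exact hit_PA_le_PB a b e c ω
    | 1 => exact le_top
    | n + 2 => exact le_top
  tendsto_top := by
    intro ω
    refine tendsto_atTop_of_eventually_const (i₀ := 2) fun n hn => ?_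
    obtain ⟨k, rfl⟩ := Nat.exists_eq_add_of_le' hn
    rfl
  h := fun n _ => hh e n
  h_bdd := fun n => ⟨|hh e n|, fun _ => le_rfl⟩
  h_meas := fun n => const_meas _ (tau_stopping a b e c n) _

theorem capital_eq (a : ℝ≥0) (b e c : ℝ) (t : ℝ≥0) (ω : Omega) :
    elemCapital (strat a b e c) c t ω =
      c + e * (ω.1 (clip (hit (PB a b e c)) t ω) - ω.1 (clip (hit (PA a b)) t ω)) := by
  unfold elemCapital
  rw [tsum_eq_single 0]
  · rfl
  · intro n hn
    obtain ⟨k, rfl⟩ := Nat.exists_eq_succ_of_ne_zero hn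
    simp [strat, hh]

theorem clip_coe {τ : Omega → ℝ≥0∞} {ω : Omega} {r : ℝ≥0} (h : τ ω = r) (t : ℝ≥0) :
    clip τ t ω = min r t := by
  unfold clip
  rw [h, ← ENNReal.coe_min, ENNReal.toNNReal_coe]

theorem clip_ge {τ : Omega → ℝ≥0∞} {ω : Omega} {t : ℝ≥0} (h : (t : ℝ≥0∞) ≤ τ ω) :
    clip τ t ω = t := by
  unfold clip
  rw [min_eq_right h, ENNReal.toNNReal_coe]

theorem coe_clip (τ : Omega → ℝ≥0∞) (ω : Omega) (t : ℝ≥0) :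
    ((clip τ t ω : ℝ≥0) : ℝ≥0∞) = min (τ ω) t := by
  unfold clip
  exact ENNReal.coe_toNNReal (ne_top_of_le_ne_top ENNReal.coe_ne_top (min_le_right _ _))

theorem capital_nonneg (a : ℝ≥0) (b e c : ℝ) (hc : 0 < c) (t : ℝ≥0) (ω : Omega) :
    0 ≤ elemCapital (strat a b e c) c t ω := by
  rw [capital_eq]
  by_cases ht : (t : ℝ≥0∞) ≤ hit (PA a b) ω
  · rw [clip_ge ht, clip_ge (ht.trans (hit_PA_le_PB a b e c ω))]
    simp [hc.le]
  rcases hit_cases (PA a b) ω (PA_closed a b ω) with ⟨h, _⟩ | ⟨s, hs, hse, hmin⟩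
  · rw [h] at ht; simp at ht
  have hst : s < t := by
    rw [hse, ENNReal.coe_le_coe] at ht; exact not_le.1 ht
  rw [clip_coe hse, min_eq_left hst.le, hs.2]
  have hu := coe_clip (hit (PB a b e c)) ω t
  set u := clip (hit (PB a b e c)) t ω
  have hsu : s ≤ u := by
    rw [← ENNReal.coe_le_coe, hu, ← hse]
    exact le_min (hit_PA_le_PB a b e c ω) (hse ▸ ENNReal.coe_le_coe.2 hst.le)
  by_contra hcon
  push Not at hcon
  have hcont : ContinuousOn (fun v => e * (ω.1 v - b)) (Set.Icc s u) :=
    (continuous_const.mul (ω.2.sub continuous_const)).continuousOn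
  have hiv := intermediate_value_Icc' hsu hcont
  have hmem : -c ∈ Set.Icc (e * (ω.1 u - b)) (e * (ω.1 s - b)) := by
    rw [hs.2]
    constructor
    · linarith
    · simp [hc.le]
  obtain ⟨v, hv, hve⟩ := hiv hmem
  simp only at hve
  have hvB : v ∈ PB a b e c ω := by
    refine ⟨s, hs, hv.1, ?_⟩
    unfold gap
    exact (min_le_left _ _).trans (by linarith)
  have h1 : u ≤ v := by
    rw [← ENNReal.coe_le_coe, hu]
    exact (min_le_left _ _).trans (hit_le_of_mem hvB)
  have : v = u := le_antisymm hv.2 h1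
  subst this
  linarith

theorem exists_int_scale {x : ℝ} (hx : x ≠ 0) : ∃ e : ℤ, 1 ≤ (e : ℝ) * x := by
  rcases lt_or_gt_of_ne hx with h | h
  · obtain ⟨n, hn⟩ := exists_nat_ge (1 / (-x))
    refine ⟨-(n : ℤ), ?_⟩
    rw [div_le_iff₀ (by linarith)] at hn
    push_cast
    linarith
  · obtain ⟨n, hn⟩ := exists_nat_ge (1 / x)
    refine ⟨(n : ℤ), ?_⟩
    rw [div_le_iff₀ h] at hn
    push_cast
    linarith

theorem capital_wins (b : ℝ) (ω : Omega) (t : ℝ≥0) (htb : ω.1 t = b) (ε : ℝ) (hε : 0 < ε)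
    (hiso : ∀ s : ℝ≥0, ω.1 s = b → s ≠ t → ε ≤ |(s : ℝ) - (t : ℝ)|) :
    ∃ (q : ℚ) (e : ℤ), ∃ T : ℝ≥0, ∀ c : ℝ, 0 < c → ∀ T' ≥ T,
      1 ≤ elemCapital (strat (Real.toNNReal q) b e c) c T' ω := by
  obtain ⟨q, hq1, hq2⟩ := exists_rat_btwn (show (t : ℝ) - ε < t by linarith)
  set r : ℝ≥0 := t + Real.toNNReal (ε / 2) with hr
  have hrr : (r : ℝ) = t + ε / 2 := by
    rw [hr, NNReal.coe_add, Real.coe_toNNReal _ (by linarith)]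
  have hne : ∀ s : ℝ≥0, t < s → s ≤ r → ω.1 s ≠ b := by
    intro s h1 h2 h3
    have h4 := hiso s h3 h1.ne'
    have h5 : (t : ℝ) < s := h1
    have h6 : (s : ℝ) ≤ r := h2
    rw [abs_of_pos (by linarith)] at h4
    linarith
  have htr : t < r := by
    rw [← NNReal.coe_lt_coe, hrr]; linarith
  obtain ⟨e, he⟩ := exists_int_scale (sub_ne_zero.2 (hne r htr le_rfl))
  refine ⟨q, e, r, fun c hc T hT => ?_⟩
  set a := Real.toNNReal (q : ℝ) with ha
  have hat : a ≤ t := by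
    rw [ha, Real.toNNReal_le_iff_le_coe]; exact hq2.le
  have hatε : (t : ℝ) - ε < a := lt_of_lt_of_le hq1 (Real.le_coe_toNNReal _)
  have htA : t ∈ PA a b ω := ⟨hat, htb⟩
  have hAmin : ∀ s ∈ PA a b ω, t ≤ s := by
    rintro s ⟨h1, h2⟩
    by_contra h3
    push Not at h3
    have h4 := hiso s h2 h3.ne
    have h5 : (s : ℝ) < t := h3
    have h6 : (a : ℝ) ≤ s := h1
    rw [abs_of_neg (by linarith)] at h4
    linarith
  have hA : hit (PA a b) ω = t :=
    le_antisymm (hit_le_of_mem htA) (le_iInf₂ fun s hs => ENNReal.coe_le_coe.2 (hAmin s hs))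
  have hrB : r ∈ PB a b e c ω := by
    refine ⟨t, htA, htr.le, ?_⟩
    unfold gap
    exact (min_le_right _ _).trans (by linarith)
  rcases hit_cases (PB a b e c) ω (PB_closed _ _ _ _ _) with ⟨_, h⟩ | ⟨ρ, hρ, hρe, hρm⟩
  · rw [h] at hrB; exact hrB.elim
  have hρr := hρm r hrB
  rw [capital_eq, clip_coe hA, clip_coe hρe, min_eq_left (hρr.trans hT),
    min_eq_left (htr.le.trans hT), htb]
  obtain ⟨s, hs, hsρ, hg⟩ := hρ
  have htρ : t ≤ ρ := (hAmin s hs).trans hsρ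
  rcases min_le_iff.1 hg with h | h
  · exfalso
    have hcont : ContinuousOn (fun v => (e : ℝ) * (ω.1 v - b)) (Set.Icc ρ r) :=
      (continuous_const.mul (ω.2.sub continuous_const)).continuousOn
    obtain ⟨v, hv, hve⟩ := intermediate_value_Icc hρr hcont
      (show (0 : ℝ) ∈ Set.Icc ((e : ℝ) * (ω.1 ρ - b)) ((e : ℝ) * (ω.1 r - b)) from
        ⟨by linarith, by linarith⟩)
    simp only at hve
    have htρ' : t < ρ := by
      refine lt_of_le_of_ne htρ ?_
      rintro rfl
      rw [htb] at h
      simp at h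
      linarith
    rcases mul_eq_zero.1 hve with h0 | h0
    · rw [h0] at he; norm_num at he
    · exact hne v (lt_of_lt_of_le htρ' hv.1) hv.2 (sub_eq_zero.1 h0)
  · linarith

/-- The combined positive capital process. -/
noncomputable def bigS (b : ℝ) (η : ℝ) (hη : 0 < η) : PosCapital where
  G := fun n => strat (Real.toNNReal ((Denumerable.eqv (ℚ × ℤ)).symm n).1) b
    ((Denumerable.eqv (ℚ × ℤ)).symm n).2 (η / 2 / 2 ^ n)
  c := fun n => η / 2 / 2 ^ n
  c_pos := fun n => by positivity
  c_summable := summable_geometric_two' η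
  nonneg := fun n t ω => capital_nonneg _ _ _ _ (by positivity) _ _

theorem bigS_init (b : ℝ) (η : ℝ) (hη : 0 < η) : (bigS b η hη).init = ENNReal.ofReal η := by
  unfold PosCapital.init
  rw [← ENNReal.ofReal_tsum_of_nonneg (fun n => ((bigS b η hη).c_pos n).le)
    (bigS b η hη).c_summable]
  congr 1
  exact tsum_geometric_two' η

/-- for every `b ∈ ℝ`, almost surely the level set
`L_ω(b) = {t ∈ [0,∞) : ω(t) = b}` has no isolated points: the set of `ω` for
which `L_ω(b)` has an isolated point is null. -/
theorem levelSet_no_isolated_points (b : ℝ) :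
    IsNull {ω : Omega | ∃ t : ℝ≥0, ω.1 t = b ∧
      ∃ ε : ℝ, 0 < ε ∧ ∀ s : ℝ≥0, ω.1 s = b → s ≠ t → ε ≤ |(s : ℝ) - (t : ℝ)|} := by
  refine le_antisymm ?_ bot_le
  refine ENNReal.le_of_forall_pos_le_add fun η hη _ => ?_
  rw [zero_add]
  have hη' : (0 : ℝ) < η := hη
  have hi := bigS_init b η hη'
  rw [ENNReal.ofReal_coe_nnreal] at hi
  rw [← hi]
  refine iInf₂_le _ ?_
  intro ω
  by_cases hω : ω ∈ {ω : Omega | ∃ t : ℝ≥0, ω.1 t = b ∧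
      ∃ ε : ℝ, 0 < ε ∧ ∀ s : ℝ≥0, ω.1 s = b → s ≠ t → ε ≤ |(s : ℝ) - (t : ℝ)|}
  · rw [Set.indicator_of_mem hω]
    obtain ⟨t, htb, ε, hε, hiso⟩ := hω
    obtain ⟨q, e, T, hT⟩ := capital_wins b ω t htb ε hε hiso
    refine le_liminf_of_le (by isBoundedDefault) ?_
    filter_upwards [eventually_ge_atTop T] with T' hT'
    unfold PosCapital.value
    refine le_trans ?_ (ENNReal.le_tsum (Denumerable.eqv (ℚ × ℤ) (q, e)))
    rw [ENNReal.one_le_ofReal]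
    have := hT _ ((bigS b η hη').c_pos (Denumerable.eqv (ℚ × ℤ) (q, e))) T' hT'
    simpa [bigS] using this
  · rw [Set.indicator_of_notMem hω]
    exact bot_le

end GTP
end

section
/- Let b ∈ ℝ. The event {ω ∈ Ω : the Lebesgue measure of the level set L_ω(b) := {t ∈ [0,∞) : ω(t) = b} is zero} is completely uncertain, i.e. both this event and its complement have upper probability 1. -/
open Filter Topology MeasureTheory
open scoped ENNReal NNReal

namespace GTP

/-- The constant path with value `a`. -/
def constPath (a : ℝ) : Omega := ⟨fun _ => a, continuous_const⟩

lemma value_constPath (S : PosCapital) (t : ℝ≥0) (a : ℝ) :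
    S.value t (constPath a) = S.init := by
  simp [PosCapital.value, PosCapital.init, elemCapital, constPath]

/-- A set containing a constant path has upper probability at least one. -/
lemma one_le_upProb {E : Set Omega} (a : ℝ) (ha : constPath a ∈ E) : 1 ≤ UpProb E := by
  refine le_iInf fun S => le_iInf fun hS => ?_
  have h := hS (constPath a)
  rw [Set.indicator_of_mem ha] at h
  simpa [value_constPath] using h

/-- The strategy that never trades. -/
noncomputable def idle : ElemStrategy where
  τ n _ := (n : ℝ≥0∞)
  stopping n t := by
    by_cases h : (n : ℝ≥0∞) ≤ (t : ℝ≥0∞) <;> simp [h]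
  mono n ω := by
    push_cast
    exact le_self_add
  tendsto_top ω := ENNReal.tendsto_nat_nhds_top
  h _ _ := 0
  h_bdd _ := ⟨0, by simp⟩
  h_meas n B hB t := by
    by_cases h : (n : ℝ≥0∞) ≤ (t : ℝ≥0∞) <;> by_cases h' : (0 : ℝ) ∈ B <;>
      simp [h, h', Set.preimage_const]

lemma elemCapital_idle (c : ℝ) (t : ℝ≥0) (ω : Omega) : elemCapital idle c t ω = c := by
  simp [elemCapital, idle]

/-- The constant unit capital. -/
noncomputable def unitCapital : PosCapital where
  G _ := idle
  c n := 1 / 2 / 2 ^ n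
  c_pos n := by positivity
  c_summable := summable_geometric_two' 1
  nonneg n t ω := by
    rw [elemCapital_idle]
    positivity

lemma unitCapital_init : unitCapital.init = 1 := by
  unfold PosCapital.init
  rw [← ENNReal.ofReal_tsum_of_nonneg (fun n => (unitCapital.c_pos n).le) unitCapital.c_summable]
  have : ∑' n, unitCapital.c n = 1 := tsum_geometric_two' 1
  simp [this]

lemma unitCapital_value (t : ℝ≥0) (ω : Omega) : unitCapital.value t ω = 1 := by
  rw [← unitCapital_init]
  simp [PosCapital.value, PosCapital.init, unitCapital, elemCapital_idle]

lemma upProb_le_one (E : Set Omega) : UpProb E ≤ 1 := by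
  refine (iInf₂_le unitCapital fun ω => ?_).trans unitCapital_init.le
  simp only [unitCapital_value, liminf_const]
  exact Set.indicator_le_self' (fun _ _ => zero_le) ω

/-- the event that the level set `L_ω(b)` has Lebesgue measure zero
is completely uncertain. -/
theorem levelSet_measure_zero_completely_uncertain (b : ℝ) :
    UpProb {ω : Omega |
        MeasureTheory.volume ((fun s : ℝ≥0 => (s : ℝ)) '' {t : ℝ≥0 | ω.1 t = b}) = 0} = 1 ∧
      UpProb {ω : Omega |
        MeasureTheory.volume ((fun s : ℝ≥0 => (s : ℝ)) '' {t : ℝ≥0 | ω.1 t = b}) = 0}ᶜ = 1 := by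
  refine ⟨le_antisymm (upProb_le_one _) (one_le_upProb (b + 1) ?_),
    le_antisymm (upProb_le_one _) (one_le_upProb b ?_)⟩
  · change volume ((fun s : ℝ≥0 => (s : ℝ)) '' {t : ℝ≥0 | b + 1 = b}) = 0
    simp
  · have h : (fun s : ℝ≥0 => (s : ℝ)) '' {t : ℝ≥0 | (constPath b).1 t = b} = Set.Ici 0 := by
      ext x
      simp only [constPath, Set.ofPred_true, Set.image_univ, Set.mem_range, Set.mem_Ici]
      exact ⟨fun ⟨y, hy⟩ => hy ▸ y.2, fun hx => ⟨⟨x, hx⟩, rfl⟩⟩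
    simp only [Set.mem_compl_iff, Set.mem_ofPred_eq]
    erw [h]
    simp

end GTP
end
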